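/- Fix an alphabet size σ ≥ 2 and let μ be the product measure on (Fin σ)^ℕ in which each coordinate is uniform on Fin σ and coordinates are independent (a uniformly random infinite σ-ary word). For ℓ ≥ 1 and an infinite word w, let z = (w₀, …, w_{ℓ−1}) be its prefix of length ℓ, and let V_ℓ(w) be the length of the shortest prefix v of the shifted word (w_ℓ, w_{ℓ+1}, …) such that Ψ(v) ≥ Ψ(z) componentwise (V_ℓ(w) = ∞ if no such prefix exists). Then there is a constant c > 0 (possibly depending on σ) such that for every ℓ ≥ 1 the expectation of V_ℓ with respect to μ is at least ℓ + c·√ℓ. -/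

import Mathlib

open MeasureTheory
open scoped ENNReal

/-- `V σ ℓ w` is the length of the shortest prefix `v` of the shifted word
`(w_ℓ, w_{ℓ+1}, …)` whose Parikh vector dominates componentwise the Parikh vector of the
prefix `z = (w_0, …, w_{ℓ-1})` of `w`; it equals `∞` if no such prefix exists. -/
noncomputable def V (σ ℓ : ℕ) (w : ℕ → Fin σ) : ℝ≥0∞ :=
  sInf {x : ℝ≥0∞ | ∃ m : ℕ, x = m ∧
    ∀ a : Fin σ, (List.ofFn fun i : Fin ℓ => w i).count a ≤
      (List.ofFn fun i : Fin m => w (ℓ + i)).count a}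

lemma count_ofFn_aux {σ : ℕ} (g : ℕ → Fin σ) (a : Fin σ) (n : ℕ) :
    (List.ofFn fun i : Fin n => g i).count a = ∑ i ∈ Finset.range n, if g i = a then 1 else 0 := by
  induction n with
  | zero => simp
  | succ n ih =>
    rw [List.ofFn_succ_last, List.count_append, Finset.sum_range_succ]
    simp only [Fin.val_castSucc, Fin.val_last]
    rw [ih]
    simp [List.count_singleton]

/-- the step variable -/
noncomputable def stepX {σ : ℕ} (a : Fin σ) (p : Fin σ × Fin σ) : ℝ :=
  (if p.1 = a then 1 else 0) - (if p.2 = a then 1 else 0)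

lemma V_lower {σ : ℕ} (ℓ : ℕ) (w : ℕ → Fin σ) (a : Fin σ) :
    (ℓ : ℝ≥0∞) + ENNReal.ofReal (max (∑ i : Fin ℓ, stepX a (w i, w (ℓ + i))) 0) ≤ V σ ℓ w := by
  unfold V
  refine le_sInf ?_
  rintro x ⟨m, rfl, hm⟩
  have hm' : ∀ b : Fin σ, (∑ i ∈ Finset.range ℓ, if w i = b then 1 else 0) ≤
      ∑ i ∈ Finset.range m, if w (ℓ + i) = b then 1 else 0 := by
    intro b
    have := hm b
    rwa [count_ofFn_aux w b ℓ, count_ofFn_aux (fun i => w (ℓ + i)) b m] at this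
  have hlm : ℓ ≤ m := by
    have := Finset.sum_le_sum (fun b (_ : b ∈ Finset.univ) => hm' b)
    rw [Finset.sum_comm, Finset.sum_comm (s := Finset.univ) (t := Finset.range m)] at this
    simpa using this
  obtain ⟨k, rfl⟩ := Nat.exists_eq_add_of_le hlm
  have h1 := hm' a
  rw [Finset.sum_range_add] at h1
  have h2 : (∑ i ∈ Finset.range k, if w (ℓ + (ℓ + i)) = a then 1 else 0) ≤ k := by
    calc _ ≤ ∑ i ∈ Finset.range k, 1 := Finset.sum_le_sum (fun i _ => by split_ifs <;> simp)
      _ = k := by simp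
  have h3 : ∑ i : Fin ℓ, stepX a (w i, w (ℓ + i)) ≤ k := by
    have h4 : ∑ i : Fin ℓ, stepX a (w i, w (ℓ + i)) =
        ∑ i ∈ Finset.range ℓ, stepX a (w i, w (ℓ + i)) :=
      Fin.sum_univ_eq_sum_range (fun i => stepX a (w i, w (ℓ + i))) ℓ
    rw [h4]
    unfold stepX
    rw [Finset.sum_sub_distrib, sub_le_iff_le_add']
    have := h1.trans (Nat.add_le_add_left h2 _)
    exact_mod_cast this
  push_cast
  gcongr
  rw [← ENNReal.ofReal_natCast]
  exact ENNReal.ofReal_le_ofReal (max_le h3 (by positivity))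

section moments
variable {A : Type} [Fintype A] (x : A → ℝ)

/-- moments -/
noncomputable def Mom (k n : ℕ) : ℝ := ∑ u : Fin n → A, (∑ i, x (u i)) ^ k

lemma Mom_succ (k n : ℕ) :
    Mom x k (n + 1) = ∑ a : A, ∑ u : Fin n → A, (x a + ∑ i, x (u i)) ^ k := by
  unfold Mom
  rw [← (Fin.consEquiv (fun _ : Fin (n+1) => A)).sum_comp, Fintype.sum_prod_type]
  simp [Fin.consEquiv, Fin.sum_univ_succ]

lemma Mom_zero (n : ℕ) : Mom x 0 n = (Fintype.card A : ℝ) ^ n := by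
  simp [Mom]

lemma Mom_one (h1 : ∑ a, x a = 0) (n : ℕ) : Mom x 1 n = 0 := by
  induction n with
  | zero => simp [Mom]
  | succ n ih =>
    have e : ∀ a, ∑ u : Fin n → A, (x a + ∑ i, x (u i)) ^ 1
        = x a * Mom x 0 n + Mom x 1 n := by
      intro a
      simp only [Mom, Finset.mul_sum, ← Finset.sum_add_distrib]
      exact Finset.sum_congr rfl fun u _ => by simp
    rw [Mom_succ, Finset.sum_congr rfl fun a _ => e a, Finset.sum_add_distrib, ← Finset.sum_mul,
      h1, ih]
    simp

lemma Mom_two (h1 : ∑ a, x a = 0) (v : ℝ) (h2 : ∑ a, x a ^ 2 = v * Fintype.card A) (n : ℕ) :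
    Mom x 2 n = n * v * (Fintype.card A : ℝ) ^ n := by
  induction n with
  | zero => simp [Mom]
  | succ n ih =>
    have e : ∀ a, ∑ u : Fin n → A, (x a + ∑ i, x (u i)) ^ 2
        = x a ^ 2 * Mom x 0 n + x a * (2 * Mom x 1 n) + Mom x 2 n := by
      intro a
      simp only [Mom, Finset.mul_sum, ← Finset.sum_add_distrib]
      exact Finset.sum_congr rfl fun u _ => by ring
    rw [Mom_succ, Finset.sum_congr rfl fun a _ => e a, Finset.sum_add_distrib,
      Finset.sum_add_distrib, ← Finset.sum_mul, ← Finset.sum_mul, h1, h2, ih, Mom_zero]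
    simp
    ring

lemma Mom_four (h1 : ∑ a, x a = 0) (v : ℝ) (hv0 : 0 ≤ v) (hv1 : v ≤ 1) (h2 : ∑ a, x a ^ 2 = v * Fintype.card A)
    (h3 : ∑ a, x a ^ 3 = 0) (h4 : ∑ a, x a ^ 4 = v * Fintype.card A) (n : ℕ) :
    Mom x 4 n ≤ 3 * n ^ 2 * v * (Fintype.card A : ℝ) ^ n := by
  induction n with
  | zero => simp [Mom]
  | succ n ih =>
    have e : ∀ a, ∑ u : Fin n → A, (x a + ∑ i, x (u i)) ^ 4
        = x a ^ 4 * Mom x 0 n + x a ^ 3 * (4 * Mom x 1 n) + x a ^ 2 * (6 * Mom x 2 n)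
          + x a * (4 * Mom x 3 n) + Mom x 4 n := by
      intro a
      simp only [Mom, Finset.mul_sum, ← Finset.sum_add_distrib]
      exact Finset.sum_congr rfl fun u _ => by ring
    rw [Mom_succ, Finset.sum_congr rfl fun a _ => e a]
    simp only [Finset.sum_add_distrib]
    simp only [← Finset.sum_mul]
    rw [h1, h2, h3, h4, Mom_zero, Mom_two x h1 v h2]
    simp only [Finset.sum_const, Finset.card_univ, nsmul_eq_mul]
    set N : ℝ := (Fintype.card A : ℝ) with hN
    have hN0 : 0 ≤ N := by positivity
    have hp : 0 ≤ N ^ (n + 1) := by positivity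
    have hi := mul_le_mul_of_nonneg_left ih hN0
    have hvv : v * v ≤ v := by nlinarith
    have hA : 0 ≤ (v - v * v) * (n * N ^ (n + 1)) :=
      mul_nonneg (by linarith) (by positivity)
    have hB : 0 ≤ v * N ^ (n + 1) := by positivity
    push_cast
    have hq : N ^ (n + 1) = N ^ n * N := pow_succ _ _
    rw [hq] at hA hB ⊢
    nlinarith

lemma pos_part_lower (h1 : ∑ a, x a = 0) (v : ℝ) (hv0 : 0 ≤ v) (hv1 : v ≤ 1)
    (h2 : ∑ a, x a ^ 2 = v * Fintype.card A)
    (h3 : ∑ a, x a ^ 3 = 0) (h4 : ∑ a, x a ^ 4 = v * Fintype.card A) (n : ℕ) (hn : 1 ≤ n) :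
    v / 16 * √n * (Fintype.card A : ℝ) ^ n ≤ ∑ u : Fin n → A, max (∑ i, x (u i)) 0 := by
  have hn' : (0 : ℝ) < n := by exact_mod_cast hn
  obtain ⟨s, hs, hs0⟩ : ∃ s : ℝ, s = √n ∧ 0 < s := ⟨_, rfl, by positivity⟩
  have hss : s ^ 2 = n := by rw [hs]; exact Real.sq_sqrt hn'.le
  have key : ∀ y : ℝ, (y ^ 1 + (1 / (2 * s)) * y ^ 2 - (1 / (8 * s ^ 3)) * y ^ 4) / 2 ≤ max y 0 := by
    intro y
    have aux : ∀ z : ℝ, 0 ≤ z → z ^ 2 - z ^ 4 ≤ z := by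
      intro z hz
      nlinarith [mul_nonneg hz (sq_nonneg (z - 1)), mul_nonneg hz (sq_nonneg z), mul_nonneg hz hz,
        mul_nonneg hz (mul_nonneg hz (sq_nonneg (z - 1))), mul_nonneg hz (sq_nonneg (2*z - 1))
        , mul_nonneg hz (mul_nonneg hz (sq_nonneg z))]
    have h := aux (|y| / (2 * s)) (by positivity)
    have h' := mul_le_mul_of_nonneg_left h (by positivity : 0 ≤ 2 * s)
    have e1 : 2 * s * (|y| / (2 * s)) = |y| := by field_simp
    have e2 : 2 * s * ((|y| / (2 * s)) ^ 2 - (|y| / (2 * s)) ^ 4)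
        = (1 / (2 * s)) * y ^ 2 - (1 / (8 * s ^ 3)) * y ^ 4 := by
      rw [div_pow, div_pow, sq_abs, show |y| ^ 4 = y ^ 4 from by
        rw [show (4:ℕ) = 2 * 2 from rfl, pow_mul, sq_abs, pow_mul]]
      field_simp
      ring
    rw [e1, e2] at h'
    have e3 : max y 0 = (y + |y|) / 2 := by
      rcases le_total 0 y with h | h
      · rw [max_eq_left h, abs_of_nonneg h]; ring
      · rw [max_eq_right h, abs_of_nonpos h]; ring
    rw [e3]; linarith
  refine le_trans ?_ (Finset.sum_le_sum fun u _ => key (∑ i, x (u i)))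
  rw [← Finset.sum_div, Finset.sum_sub_distrib, Finset.sum_add_distrib, ← Finset.mul_sum,
    ← Finset.mul_sum]
  change _ ≤ (Mom x 1 n + _ * Mom x 2 n - _ * Mom x 4 n) / 2
  have hM := mul_le_mul_of_nonneg_left (Mom_four x h1 v hv0 hv1 h2 h3 h4 n)
    (by positivity : 0 ≤ 1 / (8 * s ^ 3))
  rw [Mom_one x h1, Mom_two x h1 v h2, ← hs]
  have f1 : 1 / (2 * s) * (n * v * (Fintype.card A : ℝ) ^ n)
     = s / 2 * (v * (Fintype.card A : ℝ) ^ n) := by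
    rw [← hss]; field_simp
  have f2 : 1 / (8 * s ^ 3) * (3 * n ^ 2 * v * (Fintype.card A : ℝ) ^ n)
     = 3 * s / 8 * (v * (Fintype.card A : ℝ) ^ n) := by
    rw [← hss]; field_simp
  rw [f2] at hM
  rw [f1]
  linarith

end moments

lemma stepX_one {σ : ℕ} (a : Fin σ) : ∑ p, stepX a p = 0 := by
  unfold stepX
  rw [Finset.sum_sub_distrib, sub_eq_zero]
  exact (Equiv.prodComm (Fin σ) (Fin σ)).sum_comp
    (fun p : Fin σ × Fin σ => if p.2 = a then (1 : ℝ) else 0)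

lemma stepX_three {σ : ℕ} (a : Fin σ) : ∑ p, stepX a p ^ 3 = 0 := by
  rw [← stepX_one a]
  refine Finset.sum_congr rfl fun p _ => ?_
  unfold stepX
  split_ifs <;> norm_num

lemma stepX_four {σ : ℕ} (a : Fin σ) : ∑ p, stepX a p ^ 4 = ∑ p, stepX a p ^ 2 := by
  refine Finset.sum_congr rfl fun p _ => ?_
  unfold stepX
  split_ifs <;> norm_num

/-- pairing map -/
def pairT (σ ℓ : ℕ) (w : ℕ → Fin σ) : Fin ℓ → Fin σ × Fin σ := fun i => (w i, w (ℓ + i))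

lemma pairT_measurable (σ ℓ : ℕ) : Measurable (pairT σ ℓ) := by
  unfold pairT
  fun_prop

lemma pairT_fiber (σ : ℕ) (a : Fin σ) (ℓ : ℕ)
    (μ : Measure (ℕ → Fin σ))
    (hμ : ∀ (s : Finset ℕ) (f : ℕ → Fin σ),
      μ {w | ∀ i ∈ s, w i = f i} = ((σ : ℝ≥0∞)⁻¹) ^ s.card) (u : Fin ℓ → Fin σ × Fin σ) :
    μ.map (pairT σ ℓ) {u} = ((σ : ℝ≥0∞)⁻¹) ^ (ℓ + ℓ) := by
  rw [Measure.map_apply (pairT_measurable σ ℓ) (measurableSet_singleton u)]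
  have := hμ (Finset.range (ℓ + ℓ)) (fun i => if h : i < ℓ then (u ⟨i, h⟩).1 else
    if h : i - ℓ < ℓ then (u ⟨i - ℓ, h⟩).2 else a)
  rw [Finset.card_range] at this
  rw [← this]
  congr 1
  ext w
  simp only [Set.mem_preimage, Set.mem_singleton_iff, Set.mem_ofPred_eq, Finset.mem_range]
  constructor
  · rintro rfl i hi
    by_cases h : i < ℓ
    · simp [h, pairT]
    · have h' : i - ℓ < ℓ := by omega
      simp only [h, h', pairT, dif_pos, dif_neg, not_false_eq_true]
      congr 1
      omega
  · intro H
    funext i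
    have A := H i (by omega)
    have B := H (ℓ + i) (by omega)
    simp at A B
    simp [pairT, A, B]

theorem statement_5 (σ : ℕ) (hσ : 2 ≤ σ)
    (μ : Measure (ℕ → Fin σ)) (hprob : IsProbabilityMeasure μ)
    (hμ : ∀ (s : Finset ℕ) (f : ℕ → Fin σ),
      μ {w | ∀ i ∈ s, w i = f i} = ((σ : ℝ≥0∞)⁻¹) ^ s.card) :
    ∃ c : ℝ, 0 < c ∧ ∀ ℓ : ℕ, 1 ≤ ℓ →
      (ℓ : ℝ≥0∞) + ENNReal.ofReal (c * Real.sqrt ℓ) ≤ ∫⁻ w, V σ ℓ w ∂μ := by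
  let a : Fin σ := ⟨0, by omega⟩
  let b : Fin σ := ⟨1, by omega⟩
  have hσ0 : (0 : ℝ) < σ := by exact_mod_cast (by omega : 0 < σ)
  have hN : (Fintype.card (Fin σ × Fin σ) : ℝ) = σ ^ 2 := by simp [sq]
  have hN0 : (0 : ℝ) < (Fintype.card (Fin σ × Fin σ) : ℝ) := by rw [hN]; positivity
  let v : ℝ := (∑ p, stepX a p ^ 2) / Fintype.card (Fin σ × Fin σ)
  have h2 : ∑ p, stepX a p ^ 2 = v * Fintype.card (Fin σ × Fin σ) := by
    simp only [v]; field_simp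
  have hv0 : 0 < v := by
    refine div_pos ?_ hN0
    refine Finset.sum_pos' (fun p _ => sq_nonneg _) ⟨(a, b), Finset.mem_univ _, ?_⟩
    simp [stepX, a, b]
  have hv1 : v ≤ 1 := by
    refine div_le_one_of_le₀ ?_ hN0.le
    calc ∑ p, stepX a p ^ 2 ≤ ∑ p : Fin σ × Fin σ, (1 : ℝ) := Finset.sum_le_sum fun p _ => by
          unfold stepX
          split_ifs <;> norm_num
      _ = _ := by simp
  refine ⟨v / 16, by positivity, fun ℓ hℓ => ?_⟩
  have hmain := pos_part_lower (stepX a) (stepX_one a) v hv0.le hv1 h2 (stepX_three a)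
    ((stepX_four a).trans h2) ℓ hℓ
  calc (ℓ : ℝ≥0∞) + ENNReal.ofReal (v / 16 * √ℓ)
      ≤ ℓ + ∫⁻ w, ENNReal.ofReal (max (∑ i, stepX a (pairT σ ℓ w i)) 0) ∂μ := by
        gcongr
        rw [← lintegral_map (f := fun u : Fin ℓ → Fin σ × Fin σ =>
            ENNReal.ofReal (max (∑ i, stepX a (u i)) 0)) (measurable_of_countable _)
            (pairT_measurable σ ℓ), lintegral_fintype]
        simp only [pairT_fiber σ a ℓ μ hμ]
        rw [← Finset.sum_mul, ← ENNReal.ofReal_sum_of_nonneg (fun _ _ => le_max_right _ _)]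
        have e : ((σ : ℝ≥0∞)⁻¹) ^ (ℓ + ℓ) = ENNReal.ofReal (((σ : ℝ)⁻¹) ^ (ℓ + ℓ)) := by
          rw [ENNReal.ofReal_pow (by positivity), ENNReal.ofReal_inv_of_pos hσ0,
            ENNReal.ofReal_natCast]
        rw [e, ← ENNReal.ofReal_mul (Finset.sum_nonneg fun _ _ => le_max_right _ _)]
        apply ENNReal.ofReal_le_ofReal
        rw [inv_pow, ← div_eq_mul_inv, le_div_iff₀ (by positivity)]
        rw [hN, ← pow_mul, two_mul] at hmain
        exact hmain
    _ = ∫⁻ w, ((ℓ : ℝ≥0∞) + ENNReal.ofReal (max (∑ i, stepX a (pairT σ ℓ w i)) 0)) ∂μ := by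
        rw [lintegral_add_left measurable_const]
        simp
    _ ≤ ∫⁻ w, V σ ℓ w ∂μ := lintegral_mono fun w => V_lower ℓ w a
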